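/- arXiv:2311.15491 — 3 statements merged into one kernel-verified Lean document; each statement's English description precedes it below -/
import Mathlib

section
/- Let H₁, H₂, H₃ be complex Hilbert spaces and let T₁₁ ∈ L(H₁), T₂₂ ∈ L(H₂), T₃₃ ∈ L(H₃), T₁₂ ∈ L(H₂,H₁), T₂₃ ∈ L(H₃,H₂), T₁₃ ∈ L(H₃,H₁) be bounded operators satisfying the flag relations T₁₁T₁₂ = T₁₂T₂₂ and T₂₂T₂₃ = T₂₃T₃₃, together with Condition (A): T₁₃ = A T₁₂ T₂₃ for some bounded operator A ∈ L(H₁) with A T₁₁ = T₁₁ A. Let T and T̃ be the block operators on the Hilbert space direct sum H₁ ⊕ H₂ ⊕ H₃ with block matrices T = [[T₁₁,T₁₂,0],[0,T₂₂,T₂₃],[0,0,T₃₃]] and T̃ = [[T₁₁,T₁₂,T₁₃],[0,T₂₂,T₂₃],[0,0,T₃₃]]. Then the block operator K on H₁ ⊕ H₂ ⊕ H₃ whose only nonzero entries are K₁₂ = T₁₂ + A T₁₂, K₁₃ = T₁₃, K₂₃ = T₂₃ is such that X = I + K is invertible and X T = T̃ X. -/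
open ContinuousLinearMap

noncomputable section

/-- The element `(x, y, z)` of the Hilbert space direct sum `H₁ ⊕ H₂ ⊕ H₃`
(with the ℓ² norm, realized as an iterated `WithLp 2` product). -/
def tripleMk {H₁ H₂ H₃ : Type*}
    [NormedAddCommGroup H₁] [InnerProductSpace ℂ H₁]
    [NormedAddCommGroup H₂] [InnerProductSpace ℂ H₂]
    [NormedAddCommGroup H₃] [InnerProductSpace ℂ H₃]
    (x : H₁) (y : H₂) (z : H₃) : WithLp 2 (H₁ × WithLp 2 (H₂ × H₃)) :=
  (WithLp.equiv 2 (H₁ × WithLp 2 (H₂ × H₃))).symm (x, (WithLp.equiv 2 (H₂ × H₃)).symm (y, z))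

section tripleMk

variable {H₁ H₂ H₃ : Type*}
  [NormedAddCommGroup H₁] [InnerProductSpace ℂ H₁]
  [NormedAddCommGroup H₂] [InnerProductSpace ℂ H₂]
  [NormedAddCommGroup H₃] [InnerProductSpace ℂ H₃]

theorem tripleMk_add (x x' : H₁) (y y' : H₂) (z z' : H₃) :
    tripleMk x y z + tripleMk x' y' z' = tripleMk (x + x') (y + y') (z + z') := rfl

theorem tripleMk_zero : tripleMk (0 : H₁) (0 : H₂) (0 : H₃) = 0 := rfl

theorem ext_tripleMk
    {S S' : WithLp 2 (H₁ × WithLp 2 (H₂ × H₃)) →L[ℂ] WithLp 2 (H₁ × WithLp 2 (H₂ × H₃))}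
    (h : ∀ x y z, S (tripleMk x y z) = S' (tripleMk x y z)) : S = S' :=
  ContinuousLinearMap.ext fun v => h v.fst v.snd.fst v.snd.snd

end tripleMk

/-- Under the flag relations and Condition (A), with `T` the tridiagonal
block operator, `T̃` the full upper triangular block operator and `K` the strictly
upper triangular block operator with entries `K₁₂ = T₁₂ + A T₁₂`, `K₁₃ = T₁₃`,
`K₂₃ = T₂₃`, the operator `X = I + K` is invertible and `X T = T̃ X`. -/
theorem stmt_0
    {H₁ H₂ H₃ : Type*}
    [NormedAddCommGroup H₁] [InnerProductSpace ℂ H₁] [CompleteSpace H₁]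
    [NormedAddCommGroup H₂] [InnerProductSpace ℂ H₂] [CompleteSpace H₂]
    [NormedAddCommGroup H₃] [InnerProductSpace ℂ H₃] [CompleteSpace H₃]
    (T₁₁ : H₁ →L[ℂ] H₁) (T₂₂ : H₂ →L[ℂ] H₂) (T₃₃ : H₃ →L[ℂ] H₃)
    (T₁₂ : H₂ →L[ℂ] H₁) (T₂₃ : H₃ →L[ℂ] H₂) (T₁₃ : H₃ →L[ℂ] H₁)
    (A : H₁ →L[ℂ] H₁)
    (hflag₁ : T₁₁ ∘L T₁₂ = T₁₂ ∘L T₂₂)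
    (hflag₂ : T₂₂ ∘L T₂₃ = T₂₃ ∘L T₃₃)
    (hA : T₁₃ = A ∘L T₁₂ ∘L T₂₃)
    (hAcomm : A ∘L T₁₁ = T₁₁ ∘L A)
    (T T' K : WithLp 2 (H₁ × WithLp 2 (H₂ × H₃)) →L[ℂ] WithLp 2 (H₁ × WithLp 2 (H₂ × H₃)))
    (hT : ∀ (x : H₁) (y : H₂) (z : H₃),
      T (tripleMk x y z) = tripleMk (T₁₁ x + T₁₂ y) (T₂₂ y + T₂₃ z) (T₃₃ z))
    (hT' : ∀ (x : H₁) (y : H₂) (z : H₃),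
      T' (tripleMk x y z) = tripleMk (T₁₁ x + T₁₂ y + T₁₃ z) (T₂₂ y + T₂₃ z) (T₃₃ z))
    (hK : ∀ (x : H₁) (y : H₂) (z : H₃),
      K (tripleMk x y z) = tripleMk ((T₁₂ + A ∘L T₁₂) y + T₁₃ z) (T₂₃ z) 0) :
    IsUnit (1 + K) ∧ (1 + K) * T = T' * (1 + K) := by
  have h₁ (y : H₂) : T₁₁ (T₁₂ y) = T₁₂ (T₂₂ y) := DFunLike.congr_fun hflag₁ y
  have h₂ (z : H₃) : T₂₂ (T₂₃ z) = T₂₃ (T₃₃ z) := DFunLike.congr_fun hflag₂ z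
  have h₃ (z : H₃) : T₁₃ z = A (T₁₂ (T₂₃ z)) := DFunLike.congr_fun hA z
  have h₄ (x : H₁) : T₁₁ (A x) = A (T₁₁ x) := (DFunLike.congr_fun hAcomm x).symm
  constructor
  · have hK_cube : K ^ 3 = 0 := by
      refine ext_tripleMk fun x y z => ?_
      simp [pow_succ, hK, tripleMk_zero]
    exact IsNilpotent.isUnit_one_add ⟨3, hK_cube⟩
  · refine ext_tripleMk fun x y z => ?_
    simp only [mul_apply_eq_comp, add_apply,
      one_apply_eq_self, ContinuousLinearMap.comp_apply, hT, hT', hK, tripleMk_add, map_add,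
      h₁, h₂, h₃, h₄, add_zero]
    congr 1 <;> abel

end
end

section
/- Let ψ be a complex-valued function continuous on the closed unit disc, holomorphic on the open unit disc 𝔻, and not identically zero. Suppose that for every α ∈ 𝔻 and every θ ∈ ℝ, setting φ(z) = e^{iθ}(α − z)/(1 − conj(α)·z), there exist functions ψ₁, ψ₂ : 𝔻 → ℂ with ψ₂ nowhere vanishing on 𝔻, such that for all w ∈ 𝔻: ψ₁(w)·conj(ψ(conj(w))) = ψ₂(w)·conj(ψ(conj(φ(w))))·φ′(φ(w)). Then ψ(w) ≠ 0 for every w ∈ 𝔻. -/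
open Complex Metric

/-- The biholomorphic automorphism `z ↦ e^{iθ}(α − z)/(1 − conj(α)·z)` of the unit disc. -/
noncomputable def moebius (α : ℂ) (θ : ℝ) : ℂ → ℂ :=
  fun z => Complex.exp ((θ : ℂ) * Complex.I) * (α - z) / (1 - (starRingEnd ℂ) α * z)

open ComplexConjugate in
lemma one_sub_conj_mul_ne_zero {α z : ℂ} (hα : ‖α‖ < 1) (hz : ‖z‖ < 1) :
    1 - conj α * z ≠ 0 := by
  intro h
  have h1 : ‖conj α * z‖ = 1 := by rw [← sub_eq_zero.mp h, norm_one]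
  rw [norm_mul, RCLike.norm_conj] at h1
  nlinarith [norm_nonneg α, norm_nonneg z]

open ComplexConjugate in
lemma deriv_moebius_ne_zero {α z : ℂ} (θ : ℝ) (hα : ‖α‖ < 1) (hz : ‖z‖ < 1) :
    deriv (moebius α θ) z ≠ 0 := by
  have hd := one_sub_conj_mul_ne_zero hα hz
  have h : HasDerivAt (moebius α θ)
      ((Complex.exp (θ * I) * (-1) * (1 - conj α * z) -
        Complex.exp (θ * I) * (α - z) * (-(conj α * 1))) / (1 - conj α * z) ^ 2) z :=
    (((hasDerivAt_id z).const_sub α).const_mul _).div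
      (((hasDerivAt_id z).const_mul _).const_sub 1) hd
  have hnum : Complex.exp (θ * I) * (-1) * (1 - conj α * z) -
      Complex.exp (θ * I) * (α - z) * (-(conj α * 1)) =
      -(Complex.exp (θ * I) * (1 - conj α * α)) := by ring
  rw [h.deriv, hnum]
  exact div_ne_zero (neg_ne_zero.mpr (mul_ne_zero (Complex.exp_ne_zero _)
    (one_sub_conj_mul_ne_zero hα hα))) (pow_ne_zero 2 hd)

open ComplexConjugate in
/-- The Möbius group acts transitively on the disc: the involution exchanging `w` and `z`
is `moebius α 0` for a suitable `α`. -/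
lemma exists_moebius_eq {w z : ℂ} (hw : ‖w‖ < 1) (hz : ‖z‖ < 1) :
    ∃ α : ℂ, ‖α‖ < 1 ∧ moebius α 0 w = z := by
  have hr := norm_nonneg w
  have hs := norm_nonneg z
  have hrs : ‖w‖ * ‖z‖ < 1 := by nlinarith
  have hD : 0 < 1 - ‖w‖ ^ 2 * ‖z‖ ^ 2 := by nlinarith [mul_nonneg hr hs]
  have hDne : (1 - conj w * w * (conj z * z) : ℂ) ≠ 0 := by
    rw [Complex.conj_mul', Complex.conj_mul']
    exact_mod_cast hD.ne'
  set α : ℂ := (w * (1 - conj z * z) + z * (1 - conj w * w)) /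
    (1 - conj w * w * (conj z * z)) with hαdef
  have hα : ‖α‖ < 1 := by
    have hreal {t : ℝ} (ht : 0 < 1 - t) : ‖(1 - t : ℂ)‖ = 1 - t := by
      rw [← Complex.ofReal_one, ← Complex.ofReal_sub, Complex.norm_of_nonneg ht.le]
    have hden : ‖(1 - conj w * w * (conj z * z) : ℂ)‖ = 1 - ‖w‖ ^ 2 * ‖z‖ ^ 2 := by
      rw [Complex.conj_mul', Complex.conj_mul']
      exact_mod_cast hreal hD
    have hfac {u : ℂ} (hu : ‖u‖ < 1) : ‖(1 - conj u * u : ℂ)‖ = 1 - ‖u‖ ^ 2 := by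
      rw [Complex.conj_mul']
      exact_mod_cast hreal (by nlinarith [norm_nonneg u])
    rw [hαdef, norm_div, hden, div_lt_one hD]
    calc _ ≤ ‖w‖ * (1 - ‖z‖ ^ 2) + ‖z‖ * (1 - ‖w‖ ^ 2) := by
          refine (norm_add_le _ _).trans_eq ?_
          rw [norm_mul, norm_mul, hfac hw, hfac hz]
      _ < _ := by
          nlinarith [mul_pos (mul_pos (sub_pos.mpr hw) (sub_pos.mpr hz)) (sub_pos.mpr hrs)]
  refine ⟨α, hα, ?_⟩
  have hconj : conj α = (conj w * (1 - conj z * z) + conj z * (1 - conj w * w)) /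
      (1 - conj w * w * (conj z * z)) := by
    simp only [hαdef, map_div₀, map_add, map_sub, map_mul, map_one, Complex.conj_conj]
    congr 1 <;> ring
  have key : α - w = z * (1 - conj α * w) := by
    have h₁ := div_mul_cancel₀ (w * (1 - conj z * z) + z * (1 - conj w * w)) hDne
    have h₂ := div_mul_cancel₀ (conj w * (1 - conj z * z) + conj z * (1 - conj w * w)) hDne
    rw [← hαdef] at h₁
    rw [← hconj] at h₂
    apply mul_right_cancel₀ hDne
    linear_combination h₁ + z * w * h₂
  rw [moebius, Complex.ofReal_zero, zero_mul, Complex.exp_zero, one_mul,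
    div_eq_iff (one_sub_conj_mul_ne_zero hα hw), key]

/-- Let `ψ` be continuous on the closed unit disc, holomorphic on the
open unit disc, and not identically zero. Suppose that for every Möbius transformation
`φ = φ_{α,θ}` of the disc there are functions `ψ₁`, `ψ₂` with `ψ₂` nowhere vanishing on
`𝔻` such that `ψ₁(w)·conj(ψ(conj w)) = ψ₂(w)·conj(ψ(conj(φ(w))))·φ′(φ(w))` on `𝔻`.
Then `ψ` does not vanish on `𝔻`. -/
theorem stmt_12
    (ψ : ℂ → ℂ)
    (hcont : ContinuousOn ψ (closedBall (0 : ℂ) 1))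
    (hhol : DifferentiableOn ℂ ψ (ball (0 : ℂ) 1))
    (hne : ∃ z ∈ closedBall (0 : ℂ) 1, ψ z ≠ 0)
    (heq : ∀ α : ℂ, α ∈ ball (0 : ℂ) 1 → ∀ θ : ℝ,
      ∃ ψ₁ ψ₂ : ℂ → ℂ, (∀ w ∈ ball (0 : ℂ) 1, ψ₂ w ≠ 0) ∧
        ∀ w ∈ ball (0 : ℂ) 1,
          ψ₁ w * (starRingEnd ℂ) (ψ ((starRingEnd ℂ) w)) =
            ψ₂ w * (starRingEnd ℂ) (ψ ((starRingEnd ℂ) (moebius α θ w))) *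
              deriv (moebius α θ) (moebius α θ w)) :
    ∀ w ∈ ball (0 : ℂ) 1, ψ w ≠ 0 := by
  intro w₀ hw₀ h₀
  have hw : ‖(starRingEnd ℂ) w₀‖ < 1 := by simpa using hw₀
  have hzero : Set.EqOn ψ 0 (ball (0 : ℂ) 1) := by
    intro z hz
    have hz' : ‖(starRingEnd ℂ) z‖ < 1 := by simpa using hz
    obtain ⟨α, hα, hαz⟩ := exists_moebius_eq hw hz'
    obtain ⟨ψ₁, ψ₂, hψ₂, h⟩ := heq α (by simpa using hα) 0
    have hmem : (starRingEnd ℂ) w₀ ∈ ball (0 : ℂ) 1 := by simpa using hw₀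
    have hw_eq := h _ hmem
    rw [hαz, Complex.conj_conj, Complex.conj_conj, h₀, map_zero, mul_zero] at hw_eq
    simpa [hψ₂ _ hmem, deriv_moebius_ne_zero 0 hα hz'] using hw_eq.symm
  obtain ⟨z, hz, hψz⟩ := hne
  exact hψz (hzero.of_subset_closure hcont continuousOn_const ball_subset_closedBall
    (closure_ball (0 : ℂ) one_ne_zero).ge hz)
end

section
/- Let H be a complex Hilbert space and T a bounded operator on H whose spectrum is contained in the closed unit disc. For every α ∈ ℂ with |α| < 1 the operator I − conj(α)·T is invertible; for such α and every β ∈ ℂ with |β| = 1 define φ_{α,β}(T) = β·(α·I − T)·(I − conj(α)·T)^{−1}. Call T weakly homogeneous if for all such α and β there exists a bounded invertible operator X on H with X·φ_{α,β}(T) = T·X. Then T is weakly homogeneous if and only if its Hilbert-space adjoint T* is weakly homogeneous. -/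
open ContinuousLinearMap

/-- A bounded operator `T` (with spectrum in the closed unit disc) is *weakly homogeneous*
if for every Möbius transformation `φ_{α,β}(z) = β(α − z)/(1 − conj(α)z)` of the unit disc
(`|α| < 1`, `|β| = 1`) there is a bounded invertible operator `X` with
`X·φ_{α,β}(T) = T·X`, where `φ_{α,β}(T) = β(αI − T)(I − conj(α)T)⁻¹`. -/
def WeaklyHomogeneous {H : Type*} [NormedAddCommGroup H] [InnerProductSpace ℂ H]
    [CompleteSpace H] (T : H →L[ℂ] H) : Prop :=
  ∀ α β : ℂ, ‖α‖ < 1 → ‖β‖ = 1 →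
    ∃ X : H →L[ℂ] H, IsUnit X ∧
      X * (β • ((α • (1 : H →L[ℂ] H) - T) *
        Ring.inverse ((1 : H →L[ℂ] H) - (starRingEnd ℂ) α • T))) = T * X

/-- If the spectrum of `T` lies in the closed unit disc, then `1 - c • T` is invertible for `c` in
the open unit disc. -/
theorem isUnit_one_sub_smul_of_spectrum_subset_closedBall {A : Type*} [Ring A] [Algebra ℂ A]
    {T : A} (hσ : spectrum ℂ T ⊆ Metric.closedBall (0 : ℂ) 1) {c : ℂ} (hc : ‖c‖ < 1) :
    IsUnit (1 - c • T) := by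
  rcases eq_or_ne c 0 with rfl | h0
  · simp
  · have hmem : c⁻¹ ∉ spectrum ℂ T := fun h => by
      have h1 := hσ h
      rw [mem_closedBall_zero_iff, norm_inv] at h1
      exact absurd h1 (not_le.mpr ((one_lt_inv₀ (norm_pos_iff.mpr h0)).mpr hc))
    rw [spectrum.notMem_iff] at hmem
    have h2 := hmem.smul (Units.mk0 c h0)
    rwa [Units.smul_def, Units.val_mk0, smul_sub, Algebra.algebraMap_eq_smul_one,
      smul_inv_smul₀ h0] at h2

theorem Commute.ringInverse_right {M₀ : Type*} [MonoidWithZero M₀] {a b : M₀}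
    (h : Commute a b) : Commute a (Ring.inverse b) := by
  by_cases hb : IsUnit b
  · obtain ⟨u, rfl⟩ := hb
    rw [Ring.inverse_unit]
    exact h.units_inv_right
  · rw [Ring.inverse_non_unit b hb]
    exact Commute.zero_right a

theorem WeaklyHomogeneous.star {H : Type*} [NormedAddCommGroup H] [InnerProductSpace ℂ H]
    [CompleteSpace H] {T : H →L[ℂ] H} (hT : WeaklyHomogeneous T) :
    WeaklyHomogeneous (star T) := by
  intro α β hα hβ
  obtain ⟨X, hX, h⟩ := hT (starRingEnd ℂ α) (starRingEnd ℂ β) (by simpa using hα)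
    (by simpa using hβ)
  obtain ⟨U, hU⟩ := hX.star
  have hcomm : Commute (α • (1 : H →L[ℂ] H) - Star.star T)
      (Ring.inverse (1 - starRingEnd ℂ α • Star.star T)) := by
    refine Commute.ringInverse_right ?_
    exact ((Commute.one_left _).smul_left α).sub_left
      ((Commute.one_right _).sub_right ((Commute.refl _).smul_right _))
  have hstar := congrArg Star.star h
  simp only [star_mul, star_smul, star_sub, star_one, ← Ring.inverse_star, starRingEnd_apply,
    star_star, ← hU] at hstar hcomm ⊢
  refine ⟨↑U⁻¹, U⁻¹.isUnit, ?_⟩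
  rw [hcomm.eq, Units.inv_mul_eq_iff_eq_mul, ← mul_assoc, Units.eq_mul_inv_iff_mul_eq]
  exact hstar

/-- Let `T` be a bounded operator on a complex Hilbert space whose
spectrum is contained in the closed unit disc. Then for every `|α| < 1` the operator
`I − conj(α)T` is invertible, and `T` is weakly homogeneous if and only if its adjoint
`T*` is weakly homogeneous. -/
theorem stmt_14
    {H : Type*} [NormedAddCommGroup H] [InnerProductSpace ℂ H] [CompleteSpace H]
    (T : H →L[ℂ] H)
    (hσ : spectrum ℂ T ⊆ Metric.closedBall (0 : ℂ) 1) :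
    (∀ α : ℂ, ‖α‖ < 1 → IsUnit ((1 : H →L[ℂ] H) - (starRingEnd ℂ) α • T)) ∧
      (WeaklyHomogeneous T ↔ WeaklyHomogeneous (ContinuousLinearMap.adjoint T)) := by
  refine ⟨fun α hα => isUnit_one_sub_smul_of_spectrum_subset_closedBall hσ (by simpa using hα),
    fun h => h.star, fun h => ?_⟩
  rw [← star_eq_adjoint] at h
  simpa only [star_star] using h.star
end
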